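/- Let τ ∈ ℂ with Im τ > 0, let B ∈ GL_n(ℂ) and let v, y ∈ ℂ. Then the complex vector space Sol_{B,v,y} of holomorphic functions Φ : ℂ → Mat_{n×n}(ℂ) satisfying Φ(z+1) = Φ(z) and Φ(z+τ)·B = −exp(−2πi(z+v−y+τ))·B·Φ(z) for all z ∈ ℂ has dimension n² over ℂ. -/

import Mathlib

open Complex Matrix
open scoped TensorProduct

noncomputable section

/-- π as a complex number. -/
def πc : ℂ := Real.pi

/-- The space of holomorphic matrix-valued functions with Φ(z+1) = Φ(z) and
Φ(z+τ)·B = c(z)·B·Φ(z). -/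
def SolSpace (n : ℕ) (τ : ℂ) (B : Matrix (Fin n) (Fin n) ℂ) (c : ℂ → ℂ) :
    Submodule ℂ (ℂ → Matrix (Fin n) (Fin n) ℂ) where
  carrier := {Φ | (∀ i j, Differentiable ℂ fun z => Φ z i j) ∧
    (∀ z, Φ (z + 1) = Φ z) ∧ (∀ z, Φ (z + τ) * B = c z • (B * Φ z))}
  add_mem' := by
    rintro Φ Ψ ⟨hd, hp, hq⟩ ⟨gd, gp, gq⟩
    refine ⟨fun i j => ?_, fun z => ?_, fun z => ?_⟩
    · show Differentiable ℂ fun z => Φ z i j + Ψ z i j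
      exact (hd i j).add (gd i j)
    · show Φ (z + 1) + Ψ (z + 1) = Φ z + Ψ z
      rw [hp, gp]
    · show (Φ (z + τ) + Ψ (z + τ)) * B = c z • (B * (Φ z + Ψ z))
      rw [add_mul, hq, gq, Matrix.mul_add, smul_add]
  zero_mem' := by
    refine ⟨fun i j => ?_, fun z => rfl, fun z => by simp⟩
    show Differentiable ℂ fun _ => (0 : ℂ)
    exact differentiable_const 0
  smul_mem' := by
    rintro a Φ ⟨hd, hp, hq⟩
    refine ⟨fun i j => ?_, fun z => ?_, fun z => ?_⟩
    · show Differentiable ℂ fun z => a • Φ z i j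
      exact (hd i j).const_smul a
    · show a • Φ (z + 1) = a • Φ z
      rw [hp]
    · show (a • Φ (z + τ)) * B = c z • (B * (a • Φ z))
      rw [Matrix.smul_mul, hq, Matrix.mul_smul, smul_comm]

/-- The integral over a period of a periodic entire function does not change when the path is
shifted by a complex number. -/
theorem integral_add_eq_of_periodic {f : ℂ → ℂ} (hf : Differentiable ℂ f)
    (hp : ∀ z, f (z + 1) = f z) (τ : ℂ) :
    ∫ x in (0 : ℝ)..1, f (x + τ) = ∫ x in (0 : ℝ)..1, f x := by
  have hshift : ∫ x in (0 : ℝ)..1, f (x + τ) =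
      ∫ x in τ.re..τ.re + 1, f (x + τ.im * I) := by
    have h := intervalIntegral.integral_comp_add_right (a := 0) (b := 1)
      (fun x : ℝ => f (x + τ.im * I)) τ.re
    rw [zero_add, add_comm 1 τ.re] at h
    rw [← h]
    refine intervalIntegral.integral_congr fun x _ => ?_
    have : (x : ℂ) + τ = ((x + τ.re : ℝ) : ℂ) + τ.im * I := by
      conv_lhs => rw [← Complex.re_add_im τ]
      push_cast
      ring
    simp only [this]
  have hrect := Complex.integral_boundary_rect_eq_zero_of_differentiableOn f
    (τ.re : ℂ) ⟨τ.re + 1, τ.im⟩ hf.differentiableOn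
  have hvert : ∀ t : ℝ, f (((τ.re + 1 : ℝ) : ℂ) + t * I) = f (τ.re + t * I) := fun t => by
    rw [← hp (τ.re + t * I)]
    congr 1
    push_cast
    ring
  simp only [hvert, Complex.ofReal_re, Complex.ofReal_im, Complex.ofReal_zero, zero_mul,
    add_zero, add_sub_cancel_right, sub_eq_zero] at hrect
  have hper : Function.Periodic (fun x : ℝ => f x) 1 := fun x => by
    simpa using hp x
  have h0 := hper.intervalIntegral_add_eq τ.re 0
  rw [zero_add] at h0
  rw [hshift, ← hrect, h0]

/-- A periodic entire function with vanishing Fourier coefficients is zero. -/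
theorem eq_zero_of_fourier_eq_zero {f : ℂ → ℂ} (hf : Differentiable ℂ f)
    (hp : ∀ z, f (z + 1) = f z)
    (h : ∀ k : ℤ, ∫ x in (0 : ℝ)..1, f x * Complex.exp (-(2 * Real.pi * I * k * x)) = 0) :
    f = 0 := by
  have hper : Function.Periodic (fun x : ℝ => f x) 1 := fun x => by
    simpa using hp x
  have hcont : Continuous (fun x : ℝ => f x) := hf.continuous.comp Complex.continuous_ofReal
  let F : C(AddCircle (1 : ℝ), ℂ) := ⟨hper.lift, continuous_coinduced_dom.mpr hcont⟩
  have hF : ∀ x : ℝ, F (x : AddCircle (1 : ℝ)) = f x := fun x => hper.lift_coe x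
  have hcoeff : fourierCoeff F = 0 := by
    funext k
    rw [fourierCoeff_eq_intervalIntegral _ _ 0, Pi.zero_apply, zero_add, one_div, inv_one,
      one_smul, ← h k]
    refine intervalIntegral.integral_congr fun x _ => ?_
    simp only [hF, fourier_coe_apply, smul_eq_mul]
    rw [mul_comm]
    congr 2
    push_cast
    ring
  have hreal : ∀ x : ℝ, f x = 0 := fun x => by
    have hs := has_pointwise_sum_fourier_series_of_summable (f := F)
      (by rw [hcoeff]; exact summable_zero) (x : AddCircle (1 : ℝ))
    simp only [hcoeff, Pi.zero_apply, zero_smul, hF] at hs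
    exact hs.unique hasSum_zero
  refine AnalyticOnNhd.eq_of_frequently_eq (z₀ := 0)
    (fun z _ => hf.analyticAt z) (fun z _ => analyticAt_const) ?_
  have ht : Filter.Tendsto (fun x : ℝ => (x : ℂ)) (nhdsWithin 0 {0}ᶜ) (nhdsWithin 0 {0}ᶜ) := by
    refine tendsto_nhdsWithin_of_tendsto_nhds_of_eventually_within _ ?_ ?_
    · exact (Complex.continuous_ofReal.tendsto' 0 0 rfl).mono_left nhdsWithin_le_nhds
    · filter_upwards [self_mem_nhdsWithin] with x hx
      simpa using hx
  exact ht.frequently (Filter.Frequently.of_forall fun x => by simpa using hreal x)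

/-- Only the constant term of a theta series has a nonzero integral over a period. -/
theorem integral_jacobiTheta₂_term (k : ℤ) (d τ : ℂ) :
    ∫ x in (0 : ℝ)..1, jacobiTheta₂_term k (x + d) τ = if k = 0 then 1 else 0 := by
  split_ifs with hk
  · simp [hk, jacobiTheta₂_term]
  · have hne : (2 * Real.pi * I * k : ℂ) ≠ 0 := by
      simp [Real.pi_ne_zero, hk]
    have hterm : ∀ x : ℝ, jacobiTheta₂_term k (x + d) τ =
        Complex.exp (2 * Real.pi * I * k * x) * jacobiTheta₂_term k d τ := fun x => by
      rw [jacobiTheta₂_term, jacobiTheta₂_term, ← Complex.exp_add]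
      congr 1
      ring
    have hone : Complex.exp (2 * Real.pi * I * k) = 1 := by
      rw [mul_comm]
      exact Complex.exp_int_mul_two_pi_mul_I k
    simp only [hterm]
    rw [intervalIntegral.integral_mul_const, integral_exp_mul_complex hne]
    simp [hone]

theorem jacobiTheta₂_term_add_one (k : ℤ) (z τ : ℂ) :
    jacobiTheta₂_term k (z + 1) τ = jacobiTheta₂_term k z τ := by
  rw [jacobiTheta₂_term, jacobiTheta₂_term, Complex.exp_eq_exp_iff_exists_int]
  exact ⟨k, by ring⟩

/-- The quasi-periodicity of the terms of a theta series, centred so that no factor `exp (π I τ)`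
appears. -/
theorem jacobiTheta₂_term_add_tau (k : ℤ) (z w τ : ℂ) :
    jacobiTheta₂_term k (z + τ + (w - 1 / 2 - τ / 2)) τ =
      -Complex.exp (-(2 * Real.pi * I) * (z + w)) *
        jacobiTheta₂_term (k + 1) (z + (w - 1 / 2 - τ / 2)) τ := by
  rw [neg_eq_neg_one_mul, ← Complex.exp_pi_mul_I, jacobiTheta₂_term, jacobiTheta₂_term,
    ← Complex.exp_add, ← Complex.exp_add]
  congr 1
  push_cast
  ring

/-- A sequence indexed by `ℤ` which grows by at most the factor `exp R` in both directions grows at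
most exponentially. -/
theorem le_exp_of_step {a : ℤ → ℝ} {R : ℝ} (hup : ∀ k, a (k + 1) ≤ Real.exp R * a k)
    (hdown : ∀ k, a (k - 1) ≤ Real.exp R * a k) (k : ℤ) :
    a k ≤ a 0 * Real.exp (R * |(k : ℝ)|) := by
  have hpos : ∀ m : ℕ, a m ≤ a 0 * Real.exp (R * m) := fun m => by
    induction m with
    | zero => simp
    | succ m ih =>
      calc a ((m + 1 : ℕ) : ℤ) ≤ Real.exp R * a m := by simpa using hup m
        _ ≤ Real.exp R * (a 0 * Real.exp (R * m)) := by gcongr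
        _ = a 0 * Real.exp (R * (m + 1 : ℕ)) := by
          push_cast
          rw [mul_add, Real.exp_add, mul_one]
          ring
  have hneg : ∀ m : ℕ, a (-m) ≤ a 0 * Real.exp (R * m) := fun m => by
    induction m with
    | zero => simp
    | succ m ih =>
      calc a (-((m + 1 : ℕ) : ℤ)) ≤ Real.exp R * a (-m) := by
            have h := hdown (-m)
            rwa [show (-(m : ℤ) - 1) = -((m + 1 : ℕ) : ℤ) by push_cast; ring] at h
        _ ≤ Real.exp R * (a 0 * Real.exp (R * m)) := by gcongr
        _ = a 0 * Real.exp (R * (m + 1 : ℕ)) := by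
          push_cast
          rw [mul_add, Real.exp_add, mul_one]
          ring
  obtain ⟨m, rfl | rfl⟩ := k.eq_nat_or_neg
  · simpa using hpos m
  · simpa using hneg m

section ThetaSeries

variable {a : ℤ → ℂ} {K R : ℝ} {τ : ℂ}

theorem summable_thetaBound (hτ : 0 < τ.im) (K R S : ℝ) :
    Summable fun k : ℤ => K * (Real.exp (-Real.pi * (τ.im * k ^ 2 - 2 * S * |(k : ℝ)|)) *
      Real.exp (R * |(k : ℝ)|)) := by
  have h := (summable_pow_mul_jacobiTheta₂_term_bound (S + R / (2 * Real.pi)) hτ 0).mul_left K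
  refine h.congr fun k => ?_
  rw [pow_zero, one_mul, ← Real.exp_add]
  congr 2
  have := Real.pi_ne_zero
  push_cast
  field_simp
  ring

theorem norm_thetaTerm_le (hτ : 0 < τ.im) (ha : ∀ k, ‖a k‖ ≤ K * Real.exp (R * |(k : ℝ)|))
    {z : ℂ} {S : ℝ} (hz : |z.im| ≤ S) (k : ℤ) :
    ‖jacobiTheta₂_term k z τ * a k‖ ≤
      K * (Real.exp (-Real.pi * (τ.im * k ^ 2 - 2 * S * |(k : ℝ)|)) *
        Real.exp (R * |(k : ℝ)|)) := by
  have h := norm_jacobiTheta₂_term_le hτ hz le_rfl k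
  push_cast at h
  calc ‖jacobiTheta₂_term k z τ * a k‖ = ‖jacobiTheta₂_term k z τ‖ * ‖a k‖ := norm_mul _ _
    _ ≤ _ := mul_le_mul h (ha k) (norm_nonneg _) (Real.exp_pos _).le
    _ = _ := by ring

theorem summable_thetaTerm (hτ : 0 < τ.im) (ha : ∀ k, ‖a k‖ ≤ K * Real.exp (R * |(k : ℝ)|))
    (z : ℂ) : Summable fun k => jacobiTheta₂_term k z τ * a k :=
  .of_norm_bounded (summable_thetaBound hτ K R |z.im|) (norm_thetaTerm_le hτ ha le_rfl)

theorem differentiable_jacobiTheta₂_term (k : ℤ) (τ : ℂ) :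
    Differentiable ℂ fun z => jacobiTheta₂_term k z τ := by
  unfold jacobiTheta₂_term
  fun_prop

theorem differentiable_thetaSeries (hτ : 0 < τ.im)
    (ha : ∀ k, ‖a k‖ ≤ K * Real.exp (R * |(k : ℝ)|)) :
    Differentiable ℂ fun z => ∑' k, jacobiTheta₂_term k z τ * a k := by
  intro z
  have hU : IsOpen {w : ℂ | |w.im| < |z.im| + 1} :=
    isOpen_lt (by fun_prop) continuous_const
  refine (Complex.differentiableOn_tsum_of_summable_norm (summable_thetaBound hτ K R (|z.im| + 1))
    (fun k => ((differentiable_jacobiTheta₂_term k τ).mul_const (a k)).differentiableOn) hU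
    fun k w hw => norm_thetaTerm_le hτ ha (le_of_lt hw) k).differentiableAt (hU.mem_nhds ?_)
  simp

/-- The constant Fourier coefficient of a theta series. -/
theorem integral_thetaSeries (hτ : 0 < τ.im)
    (ha : ∀ k, ‖a k‖ ≤ K * Real.exp (R * |(k : ℝ)|)) (d : ℂ) :
    ∫ x in (0 : ℝ)..1, ∑' k, jacobiTheta₂_term k (x + d) τ * a k = a 0 := by
  obtain ⟨u, hu, hbound⟩ : ∃ u : ℤ → ℝ, Summable u ∧
      ∀ (k : ℤ) (x : ℝ), ‖jacobiTheta₂_term k (x + d) τ * a k‖ ≤ u k :=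
    ⟨_, summable_thetaBound hτ K R |d.im|, fun k x => norm_thetaTerm_le hτ ha (by simp) k⟩
  have h : HasSum (fun k => ∫ x in (0 : ℝ)..1, jacobiTheta₂_term k (x + d) τ * a k)
      (∫ x in (0 : ℝ)..1, ∑' k, jacobiTheta₂_term k (x + d) τ * a k) := by
    refine intervalIntegral.hasSum_integral_of_dominated_convergence (fun k _ => u k) (fun k => ?_)
      (fun k => .of_forall fun x _ => hbound k x) (.of_forall fun _ _ => hu)
      intervalIntegrable_const
      (.of_forall fun x _ => (summable_thetaTerm hτ ha (x + d)).hasSum)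
    exact Continuous.aestronglyMeasurable
      (((differentiable_jacobiTheta₂_term k τ).continuous.comp (by fun_prop)).mul_const _)
  have hterm : (fun k => ∫ x in (0 : ℝ)..1, jacobiTheta₂_term k (x + d) τ * a k) =
      fun k => if k = 0 then a 0 else 0 := by
    funext k
    rw [intervalIntegral.integral_mul_const, integral_jacobiTheta₂_term]
    split_ifs with hk
    · rw [hk, one_mul]
    · rw [zero_mul]
  rw [hterm] at h
  exact h.unique (hasSum_ite_eq 0 (a 0))

end ThetaSeries

section Conjugation

variable {n : ℕ}

/-- The sequence of conjugates of a matrix by the powers of a unit. -/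
def conjZPow (u : (Matrix (Fin n) (Fin n) ℂ)ˣ) (M : Matrix (Fin n) (Fin n) ℂ) (k : ℤ) :
    Matrix (Fin n) (Fin n) ℂ :=
  (u ^ (-k)).val * M * (u ^ k).val

theorem conjZPow_zero (u : (Matrix (Fin n) (Fin n) ℂ)ˣ) (M : Matrix (Fin n) (Fin n) ℂ) :
    conjZPow u M 0 = M := by
  simp [conjZPow]

theorem conjZPow_add_one (u : (Matrix (Fin n) (Fin n) ℂ)ˣ) (M : Matrix (Fin n) (Fin n) ℂ)
    (k : ℤ) : conjZPow u M (k + 1) = (u⁻¹).val * conjZPow u M k * u.val := by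
  rw [conjZPow, conjZPow, _root_.zpow_add_one, neg_add_rev, _root_.zpow_add, _root_.zpow_neg_one]
  simp only [Units.val_mul, mul_assoc]

theorem conjZPow_sub_one (u : (Matrix (Fin n) (Fin n) ℂ)ˣ) (M : Matrix (Fin n) (Fin n) ℂ)
    (k : ℤ) : conjZPow u M (k - 1) = u.val * conjZPow u M k * (u⁻¹).val := by
  rw [conjZPow, conjZPow, _root_.zpow_sub_one, neg_sub, sub_eq_add_neg, _root_.zpow_add, _root_.zpow_one]
  simp only [Units.val_mul, mul_assoc]

attribute [local instance] Matrix.linftyOpNormedRing in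
theorem exists_norm_conjZPow_le (u : (Matrix (Fin n) (Fin n) ℂ)ˣ)
    (M : Matrix (Fin n) (Fin n) ℂ) :
    ∃ K R : ℝ, ∀ i j k, ‖conjZPow u M k i j‖ ≤ K * Real.exp (R * |(k : ℝ)|) := by
  have hC : ‖u.val‖ * ‖(u⁻¹).val‖ ≤ Real.exp (‖u.val‖ * ‖(u⁻¹).val‖) := by
    linarith [Real.add_one_le_exp (‖u.val‖ * ‖(u⁻¹).val‖)]
  refine ⟨‖conjZPow u M 0‖, ‖u.val‖ * ‖(u⁻¹).val‖, fun i j k => ?_⟩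
  have hentry : ‖conjZPow u M k i j‖ ≤ ‖conjZPow u M k‖ := by
    rw [Matrix.linfty_opNorm_def, ← coe_nnnorm, NNReal.coe_le_coe]
    exact (Finset.single_le_sum (f := fun j => ‖conjZPow u M k i j‖₊) (fun _ _ => zero_le)
      (Finset.mem_univ j)).trans
      (Finset.le_sup (f := fun i => ∑ j, ‖conjZPow u M k i j‖₊) (Finset.mem_univ i))
  refine hentry.trans (le_exp_of_step (a := fun k => ‖conjZPow u M k‖) (fun k => ?_)
    (fun k => ?_) k)
  · refine le_trans ?_ (mul_le_mul_of_nonneg_right hC (norm_nonneg (conjZPow u M k)))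
    rw [conjZPow_add_one]
    refine norm_mul₃_le.trans_eq ?_
    ring
  · refine le_trans ?_ (mul_le_mul_of_nonneg_right hC (norm_nonneg (conjZPow u M k)))
    rw [conjZPow_sub_one]
    refine norm_mul₃_le.trans_eq ?_
    ring

end Conjugation

section Solutions

variable {n : ℕ} {τ : ℂ} {B : Matrix (Fin n) (Fin n) ℂ}

/-- The Fourier coefficients of a matrix-valued function. -/
def matFourierCoeff (Φ : ℂ → Matrix (Fin n) (Fin n) ℂ) (k : ℤ) : Matrix (Fin n) (Fin n) ℂ :=
  Matrix.of fun i j =>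
    ∫ x in (0 : ℝ)..1, Φ x i j * Complex.exp (-(2 * Real.pi * I * k * x))

theorem intervalIntegrable_fourier {f : ℂ → ℂ} (hf : Differentiable ℂ f) (k : ℤ) :
    IntervalIntegrable (fun x : ℝ => f x * Complex.exp (-(2 * Real.pi * I * k * x)))
      MeasureTheory.volume 0 1 := by
  have := hf.continuous
  exact Continuous.intervalIntegrable (by fun_prop) 0 1

/-- The Fourier coefficients of the translate of a periodic entire function. -/
theorem integral_translate_mul_exp {f : ℂ → ℂ} (hf : Differentiable ℂ f)
    (hp : ∀ z, f (z + 1) = f z) (τ : ℂ) (k : ℤ) :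
    ∫ x in (0 : ℝ)..1, f (x + τ) * Complex.exp (-(2 * Real.pi * I * k * x)) =
      Complex.exp (2 * Real.pi * I * k * τ) *
        ∫ x in (0 : ℝ)..1, f x * Complex.exp (-(2 * Real.pi * I * k * x)) := by
  have h := integral_add_eq_of_periodic
    (f := fun z => f z * Complex.exp (-(2 * Real.pi * I * k * z)))
    (hf.mul (by fun_prop)) (fun z => by
      rw [hp]
      congr 1
      rw [Complex.exp_eq_exp_iff_exists_int]
      exact ⟨-k, by push_cast; ring⟩) τ
  rw [← h, ← intervalIntegral.integral_const_mul]
  refine intervalIntegral.integral_congr fun x _ => ?_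
  rw [mul_left_comm, ← Complex.exp_add]
  congr 2
  ring

theorem matFourierCoeff_rec {w : ℂ} {Φ : ℂ → Matrix (Fin n) (Fin n) ℂ}
    (hΦ : Φ ∈ SolSpace n τ B (fun z => -Complex.exp (-(2 * Real.pi * I) * (z + w)))) (k : ℤ) :
    Complex.exp (2 * Real.pi * I * k * τ) • (matFourierCoeff Φ k * B) =
      -Complex.exp (-(2 * Real.pi * I) * w) • (B * matFourierCoeff Φ (k + 1)) := by
  obtain ⟨hd, hp, hq⟩ := hΦ
  ext i j
  have hl : Complex.exp (2 * Real.pi * I * k * τ) * (matFourierCoeff Φ k * B) i j =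
      ∫ x in (0 : ℝ)..1, (Φ (x + τ) * B) i j * Complex.exp (-(2 * Real.pi * I * k * x)) := by
    rw [integral_translate_mul_exp (f := fun z => (Φ z * B) i j) _ _ τ k]
    · simp only [Matrix.mul_apply, Finset.sum_mul]
      rw [intervalIntegral.integral_finsetSum fun l _ =>
        intervalIntegrable_fourier ((hd i l).mul_const _) k]
      congr 1
      refine Finset.sum_congr rfl fun l _ => ?_
      rw [matFourierCoeff, Matrix.of_apply, ← intervalIntegral.integral_mul_const]
      congr 1
      funext x
      ring
    · simp only [Matrix.mul_apply]
      exact Differentiable.fun_sum fun l _ => (hd i l).mul_const _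
    · simp [hp]
  have hr : -Complex.exp (-(2 * Real.pi * I) * w) * (B * matFourierCoeff Φ (k + 1)) i j =
      ∫ x in (0 : ℝ)..1, (Φ (x + τ) * B) i j * Complex.exp (-(2 * Real.pi * I * k * x)) := by
    have hx : ∀ x : ℝ, (Φ (x + τ) * B) i j * Complex.exp (-(2 * Real.pi * I * k * x)) =
        -Complex.exp (-(2 * Real.pi * I) * w) * ∑ l, (B i l * Φ x l j) *
          Complex.exp (-(2 * Real.pi * I * (k + 1 : ℤ) * x)) := fun x => by
      rw [hq, Matrix.smul_apply, smul_eq_mul, Matrix.mul_apply, ← Finset.sum_mul]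
      have he : Complex.exp (-(2 * Real.pi * I) * (x + w)) *
          Complex.exp (-(2 * Real.pi * I * k * x)) =
          Complex.exp (-(2 * Real.pi * I) * w) *
          Complex.exp (-(2 * Real.pi * I * (k + 1 : ℤ) * x)) := by
        rw [← Complex.exp_add, ← Complex.exp_add]
        congr 1
        push_cast
        ring
      linear_combination (-∑ l, B i l * Φ x l j) * he
    simp only [hx]
    rw [intervalIntegral.integral_const_mul, intervalIntegral.integral_finsetSum fun l _ =>
        intervalIntegrable_fourier ((hd l j).const_mul _) (k + 1), Matrix.mul_apply]
    congr 1
    refine Finset.sum_congr rfl fun l _ => ?_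
    rw [matFourierCoeff, Matrix.of_apply, ← intervalIntegral.integral_const_mul]
    congr 1
    funext x
    ring
  rw [Matrix.smul_apply, Matrix.smul_apply, smul_eq_mul, smul_eq_mul, hl, hr]

theorem eq_zero_of_matFourierCoeff_zero {w : ℂ} (hB : IsUnit B)
    {Φ : ℂ → Matrix (Fin n) (Fin n) ℂ}
    (hΦ : Φ ∈ SolSpace n τ B (fun z => -Complex.exp (-(2 * Real.pi * I) * (z + w))))
    (h0 : matFourierCoeff Φ 0 = 0) : Φ = 0 := by
  have hall : ∀ k, matFourierCoeff Φ k = 0 := fun k => by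
    induction k with
    | zero => exact h0
    | succ m ih =>
      have h := matFourierCoeff_rec hΦ m
      rw [ih, zero_mul, smul_zero, eq_comm, smul_eq_zero_iff_right (by simp),
        hB.mul_right_eq_zero] at h
      exact h
    | pred m ih =>
      have h := matFourierCoeff_rec hΦ (-m - 1)
      rw [sub_add_cancel, ih, mul_zero, smul_zero, smul_eq_zero_iff_right (Complex.exp_ne_zero _),
        hB.mul_left_eq_zero] at h
      exact h
  obtain ⟨hd, hp, -⟩ := hΦ
  funext z
  ext i j
  exact congrFun (eq_zero_of_fourier_eq_zero (hd i j) (fun z => by rw [hp]) fun k =>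
    congrFun (congrFun (hall k) i) j) z

/-- The solution with prescribed constant Fourier coefficient. -/
theorem exists_mem_SolSpace_matFourierCoeff_eq (hτ : 0 < τ.im) (w : ℂ) (hB : IsUnit B)
    (M : Matrix (Fin n) (Fin n) ℂ) :
    ∃ Φ ∈ SolSpace n τ B (fun z => -Complex.exp (-(2 * Real.pi * I) * (z + w))),
      matFourierCoeff Φ 0 = M := by
  obtain ⟨u, rfl⟩ := hB
  obtain ⟨K, R, hKR⟩ := exists_norm_conjZPow_le u M
  set d : ℂ := w - 1 / 2 - τ / 2 with hd
  let Φ : ℂ → Matrix (Fin n) (Fin n) ℂ := fun z =>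
    Matrix.of fun i j => ∑' k, jacobiTheta₂_term k (z + d) τ * conjZPow u M k i j
  have hsum : ∀ z, HasSum (fun k => jacobiTheta₂_term k (z + d) τ • conjZPow u M k) (Φ z) :=
    fun z => Pi.hasSum.mpr fun i => Pi.hasSum.mpr fun j =>
      (summable_thetaTerm hτ (hKR i j) (z + d)).hasSum
  refine ⟨Φ, ⟨fun i j => ?_, fun z => ?_, fun z => ?_⟩, ?_⟩
  · exact (differentiable_thetaSeries hτ (hKR i j)).comp (differentiable_id.add_const d)
  · have h := hsum (z + 1)
    simp only [add_right_comm z 1 d, jacobiTheta₂_term_add_one] at h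
    exact h.unique (hsum z)
  · have hl := (hsum (z + τ)).mul_right (u : Matrix (Fin n) (Fin n) ℂ)
    have hr := (((Equiv.addRight (1 : ℤ)).hasSum_iff.mpr (hsum z)).mul_left
      (u : Matrix (Fin n) (Fin n) ℂ)).const_smul
        (-Complex.exp (-(2 * Real.pi * I) * (z + w)))
    refine hl.unique (hr.congr_fun ?_)
    intro k
    simp only [hd, Function.comp_apply, Equiv.coe_addRight, conjZPow_add_one]
    rw [jacobiTheta₂_term_add_tau, Matrix.smul_mul, Matrix.mul_smul, smul_smul]
    simp only [← mul_assoc, Units.mul_inv, one_mul]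
  · ext i j
    simpa [matFourierCoeff, Φ, conjZPow_zero] using integral_thetaSeries hτ (hKR i j) d

/-- The constant Fourier coefficient determines a solution, and may be prescribed. -/
def constCoeffEquiv (hτ : 0 < τ.im) (w : ℂ) (hB : IsUnit B) :
    SolSpace n τ B (fun z => -Complex.exp (-(2 * Real.pi * I) * (z + w))) ≃ₗ[ℂ]
      Matrix (Fin n) (Fin n) ℂ :=
  LinearEquiv.ofBijective
    { toFun := fun Φ => matFourierCoeff Φ.1 0
      map_add' := fun Φ Ψ => by
        ext i j
        simp only [matFourierCoeff, Matrix.of_apply, Matrix.add_apply, Submodule.coe_add,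
          Pi.add_apply, add_mul]
        exact intervalIntegral.integral_add (intervalIntegrable_fourier (Φ.2.1 i j) 0)
          (intervalIntegrable_fourier (Ψ.2.1 i j) 0)
      map_smul' := fun a Φ => by
        ext i j
        simp only [matFourierCoeff, Matrix.of_apply, Matrix.smul_apply, Submodule.coe_smul,
          Pi.smul_apply, smul_eq_mul, mul_assoc, RingHom.id_apply]
        exact intervalIntegral.integral_const_mul _ _ }
    ⟨(injective_iff_map_eq_zero _).mpr fun Φ h =>
        Subtype.ext (eq_zero_of_matFourierCoeff_zero hB Φ.2 h),
      fun M => by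
        obtain ⟨Φ, hΦ, h⟩ := exists_mem_SolSpace_matFourierCoeff_eq hτ w hB M
        exact ⟨⟨Φ, hΦ⟩, h⟩⟩

end Solutions

/-- The space of solutions Sol_{B,v,y} has dimension n² over ℂ. -/
theorem dim_SolSpace (n : ℕ) (τ : ℂ) (hτ : 0 < τ.im)
    (B : Matrix (Fin n) (Fin n) ℂ) (hB : IsUnit B) (v y : ℂ) :
    Module.rank ℂ ↥(SolSpace n τ B
      (fun z => -Complex.exp (-(2 * πc * I) * (z + v - y + τ)))) = (n ^ 2 : ℕ) := by
  have hc : (fun z : ℂ => -Complex.exp (-(2 * πc * I) * (z + v - y + τ))) =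
      fun z => -Complex.exp (-(2 * Real.pi * I) * (z + (v - y + τ))) := by
    funext z
    rw [πc, ← add_assoc, add_sub_assoc]
  rw [hc, (constCoeffEquiv hτ (v - y + τ) hB).rank_eq]
  simp [sq]
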